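/- Let G be a connected unbalanced signed graph with n vertices, m edges, and a fixed linear order ≺ on its edge set E, and let F ⊆ E be a subset that contains no broken bond of G as a subset. Then |F| = m−n if and only if every connected component of G − F contains exactly one circuit, and that circuit is unbalanced. -/

import Mathlib

/-- A signed graph: each edge `e` has endpoints `a e`, `b e` (equal for a loop)
and a sign `sign e ∈ {1, -1}`. -/
structure SignedGraph (V E : Type) where
  a : E → V
  b : E → V
  sign : E → ℤ
  sign_unit : ∀ e, sign e = 1 ∨ sign e = -1

namespace SignedGraph

variable {V E : Type}

/-- An orientation of a signed graph: incidence signs `ηa e`, `ηb e ∈ {1,-1}` at the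
two ends of each edge, with `ηa e * ηb e = - sign e`. -/
structure Orientation (G : SignedGraph V E) where
  ηa : E → ℤ
  ηb : E → ℤ
  ηa_unit : ∀ e, ηa e = 1 ∨ ηa e = -1
  ηb_unit : ∀ e, ηb e = 1 ∨ ηb e = -1
  compat : ∀ e, ηa e * ηb e = - G.sign e

/-- Kirchhoff's law at every vertex: a `Γ`-flow. -/
def IsFlow [Fintype E] [DecidableEq V] {Γ : Type} [AddCommGroup Γ]
    (G : SignedGraph V E) (O : G.Orientation) (f : E → Γ) : Prop :=
  ∀ v : V, ∑ e : E,
    ((if G.a e = v then O.ηa e else 0) + (if G.b e = v then O.ηb e else 0)) • f e = 0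

/-- Degree of a vertex in the subgraph with edge set `S` (a loop counts twice). -/
def deg [DecidableEq V] (G : SignedGraph V E) (S : Finset E) (v : V) : ℕ :=
  ∑ e ∈ S, ((if G.a e = v then 1 else 0) + (if G.b e = v then 1 else 0))

/-- Adjacency via an edge in the edge set `S`. -/
def AdjIn (G : SignedGraph V E) (S : Finset E) (v w : V) : Prop :=
  ∃ e ∈ S, (G.a e = v ∧ G.b e = w) ∨ (G.a e = w ∧ G.b e = v)

/-- A circuit: a nonempty edge set forming a connected 2-regular subgraph. -/
def IsCircuit [DecidableEq V] (G : SignedGraph V E) (C : Finset E) : Prop :=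
  C.Nonempty ∧
  (∀ v : V, (∃ e ∈ C, G.a e = v ∨ G.b e = v) → G.deg C v = 2) ∧
  (∀ v w : V, (∃ e ∈ C, G.a e = v ∨ G.b e = v) → (∃ e ∈ C, G.a e = w ∨ G.b e = w) →
     Relation.ReflTransGen (G.AdjIn C) v w)

/-- An unbalanced circuit: a circuit with an odd number of negative edges. -/
def IsUnbalancedCircuit [DecidableEq V] (G : SignedGraph V E) (C : Finset E) : Prop :=
  G.IsCircuit C ∧ Odd (C.filter (fun e => G.sign e = -1)).card

/-- The subgraph with edge set `S` is balanced (contains no unbalanced circuit). -/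
def BalancedOn [DecidableEq V] (G : SignedGraph V E) (S : Finset E) : Prop :=
  ∀ C : Finset E, C ⊆ S → ¬ G.IsUnbalancedCircuit C

/-- A balanced signed graph: contains no unbalanced circuit. -/
def Balanced [DecidableEq V] (G : SignedGraph V E) : Prop :=
  ∀ C : Finset E, ¬ G.IsUnbalancedCircuit C

/-- An unbalanced signed graph: contains an unbalanced circuit. -/
def Unbalanced [DecidableEq V] (G : SignedGraph V E) : Prop :=
  ∃ C : Finset E, G.IsUnbalancedCircuit C

/-- Adjacency in the whole signed graph. -/
def Adj (G : SignedGraph V E) (v w : V) : Prop :=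
  ∃ e : E, (G.a e = v ∧ G.b e = w) ∨ (G.a e = w ∧ G.b e = v)

/-- A connected signed graph: every two vertices are joined by a walk. -/
def Connected (G : SignedGraph V E) : Prop :=
  ∀ v w : V, Relation.ReflTransGen G.Adj v w

/-- The setoid on vertices whose classes are the connected components. -/
def compSetoid (G : SignedGraph V E) : Setoid V :=
  ⟨Relation.EqvGen G.Adj, Relation.EqvGen.is_equivalence _⟩

/-- The connected component of a vertex. -/
def component (G : SignedGraph V E) (v : V) : Quotient G.compSetoid :=
  Quotient.mk G.compSetoid v

/-- The number of vertices of a connected component. -/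
noncomputable def compN (G : SignedGraph V E) (q : Quotient G.compSetoid) : ℕ :=
  Nat.card {v : V // G.component v = q}

/-- The number of edges of a connected component. -/
noncomputable def compM (G : SignedGraph V E) (q : Quotient G.compSetoid) : ℕ :=
  Nat.card {e : E // G.component (G.a e) = q}

/-- The connected component `q` is unbalanced (contains an unbalanced circuit). -/
def CompUnbalanced [DecidableEq V] (G : SignedGraph V E) (q : Quotient G.compSetoid) : Prop :=
  ∃ C : Finset E, G.IsUnbalancedCircuit C ∧ ∃ e ∈ C, G.component (G.a e) = q

open Classical in
/-- `β` of a connected component: `m - n` if unbalanced, `m - n + 1` if balanced. -/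
noncomputable def compBeta [DecidableEq V] (G : SignedGraph V E)
    (q : Quotient G.compSetoid) : ℕ :=
  if G.CompUnbalanced q then G.compM q - G.compN q else G.compM q + 1 - G.compN q

/-- `β(G)`: the sum of `β(ω)` over the connected components `ω` of `G`. -/
noncomputable def beta [DecidableEq V] (G : SignedGraph V E) : ℕ :=
  ∑ᶠ q : Quotient G.compSetoid, G.compBeta q

/-- `κ(G)`: the number of unbalanced connected components of `G`. -/
noncomputable def kappa [DecidableEq V] (G : SignedGraph V E) : ℕ :=
  Nat.card {q : Quotient G.compSetoid // G.CompUnbalanced q}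

/-- The signed graph `G - F` obtained by deleting the edges in `F` (all vertices kept). -/
def delete [DecidableEq E] (G : SignedGraph V E) (F : Finset E) :
    SignedGraph V {e : E // e ∉ F} :=
  ⟨fun e => G.a e.1, fun e => G.b e.1, fun e => G.sign e.1, fun e => G.sign_unit e.1⟩

/-- The edges with both endpoints in `X` (the edge set of `G[X]`). -/
def insideEdges [Fintype E] [DecidableEq V] (G : SignedGraph V E) (X : Finset V) : Finset E :=
  Finset.univ.filter (fun e => G.a e ∈ X ∧ G.b e ∈ X)

/-- The edges with one endpoint in `X` and one outside: `[X, Xᶜ]`. -/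
def crossEdges [Fintype E] [DecidableEq V] (G : SignedGraph V E) (X : Finset V) : Finset E :=
  Finset.univ.filter (fun e => (G.a e ∈ X ∧ G.b e ∉ X) ∨ (G.a e ∉ X ∧ G.b e ∈ X))

/-- A cut: a nonempty set `B = [X, Xᶜ] ∪ E_X` where `X` is a nonempty vertex set and `E_X`
is a set of edges of `G[X]` minimal with `G[X] - E_X` balanced. -/
def IsCut [Fintype E] [DecidableEq V] [DecidableEq E]
    (G : SignedGraph V E) (B : Finset E) : Prop :=
  B.Nonempty ∧ ∃ X : Finset V, X.Nonempty ∧ ∃ EX : Finset E,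
    EX ⊆ G.insideEdges X ∧
    G.BalancedOn (G.insideEdges X \ EX) ∧
    (∀ EX' ⊆ EX, G.BalancedOn (G.insideEdges X \ EX') → EX' = EX) ∧
    B = G.crossEdges X ∪ EX

/-- A bond: a cut that is minimal (under inclusion) among cuts. -/
def IsBond [Fintype E] [DecidableEq V] [DecidableEq E]
    (G : SignedGraph V E) (B : Finset E) : Prop :=
  G.IsCut B ∧ ∀ B' ⊆ B, G.IsCut B' → B' = B

/-- A broken bond: a bond minus its largest edge (w.r.t. the linear order on `E`). -/
def IsBrokenBond [Fintype E] [DecidableEq V] [LinearOrder E]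
    (G : SignedGraph V E) (D : Finset E) : Prop :=
  ∃ B : Finset E, G.IsBond B ∧ ∃ h : B.Nonempty, D = B.erase (B.max' h)

/-- `F` contains no broken bond of `G` as a subset. -/
def NoBrokenBond [Fintype E] [DecidableEq V] [LinearOrder E]
    (G : SignedGraph V E) (F : Finset E) : Prop :=
  ∀ D : Finset E, G.IsBrokenBond D → ¬ D ⊆ F

end SignedGraph

/-- `ε(Γ)`: the largest `d` such that `Γ` has a subgroup isomorphic to `(ℤ/2ℤ)^d`. -/
noncomputable def epsilon (Γ : Type) [AddCommGroup Γ] [Fintype Γ] : ℕ :=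
  sSup {d : ℕ | ∃ H : AddSubgroup Γ, Nonempty (H ≃+ (Fin d → ZMod 2))}

namespace SignedGraph

section Degree

variable {V E : Type} [DecidableEq V]

lemma deg_sdiff_add_deg [DecidableEq E] (G : SignedGraph V E) {S T : Finset E} (h : T ⊆ S)
    (v : V) : G.deg (S \ T) v + G.deg T v = G.deg S v :=
  Finset.sum_sdiff h

lemma deg_pos (G : SignedGraph V E) {S : Finset E} {v : V}
    (h : ∃ e ∈ S, G.a e = v ∨ G.b e = v) : 0 < G.deg S v := by
  obtain ⟨e, he, h⟩ := h
  refine Finset.sum_pos' (fun _ _ => Nat.zero_le _) ⟨e, he, ?_⟩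
  rcases h with h | h <;> simp [h]

lemma deg_eq_zero (G : SignedGraph V E) {S : Finset E} {v : V}
    (h : ¬ ∃ e ∈ S, G.a e = v ∨ G.b e = v) : G.deg S v = 0 := by
  push Not at h
  refine Finset.sum_eq_zero fun e he => ?_
  simp [h e he]

lemma sum_deg [Fintype V] (G : SignedGraph V E) (S : Finset E) :
    ∑ v, G.deg S v = 2 * S.card := by
  unfold deg
  rw [Finset.sum_comm]
  simp [Finset.sum_add_distrib, mul_comm]

lemma IsCircuit.even_deg {G : SignedGraph V E} {C : Finset E} (h : G.IsCircuit C) (v : V) :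
    Even (G.deg C v) := by
  by_cases hv : ∃ e ∈ C, G.a e = v ∨ G.b e = v
  · rw [h.2.1 v hv]; exact even_two
  · rw [G.deg_eq_zero hv]; exact Even.zero

lemma even_deg_symmDiff [DecidableEq E] (G : SignedGraph V E) {S T : Finset E} {v : V}
    (h : Odd (G.deg S v) ↔ Odd (G.deg T v)) : Even (G.deg (symmDiff S T) v) := by
  have h1 := G.deg_sdiff_add_deg (Finset.inter_subset_left : S ∩ T ⊆ S) v
  have h2 := G.deg_sdiff_add_deg (Finset.inter_subset_right : S ∩ T ⊆ T) v
  have h3 : G.deg (symmDiff S T) v = G.deg (S \ (S ∩ T)) v + G.deg (T \ (S ∩ T)) v := by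
    rw [Finset.sdiff_inter_self_left, Finset.inter_comm S T, Finset.sdiff_inter_self_left]
    exact Finset.sum_union disjoint_sdiff_sdiff
  grind

/-- A minimal nonempty edge set with all degrees even is a circuit. -/
lemma isCircuit_of_minimal [Fintype V] [DecidableEq E] (G : SignedGraph V E) {C : Finset E}
    (hne : C.Nonempty) (heven : ∀ v, Even (G.deg C v))
    (hmin : ∀ D ⊆ C, D.Nonempty → (∀ v, Even (G.deg D v)) → D = C) : G.IsCircuit C := by
  classical
  refine ⟨hne, ?_, ?_⟩
  · set T : Finset V := Finset.univ.filter fun v => ∃ e ∈ C, G.a e = v ∨ G.b e = v with hT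
    have hsumT : ∀ D ⊆ C, ∑ v ∈ T, G.deg D v = 2 * D.card := by
      intro D hD
      rw [← G.sum_deg D]
      refine Finset.sum_subset (Finset.subset_univ _) fun v _ hv => G.deg_eq_zero ?_
      rintro ⟨e, he, h⟩
      exact hv (by simp only [hT, Finset.mem_filter, Finset.mem_univ, true_and]
                   exact ⟨e, hD he, h⟩)
    have hcard : C.card ≤ T.card := by
      by_contra! hlt
      obtain ⟨e₀, he₀⟩ := hne
      have hv₀ : G.a e₀ ∈ T := by
        simp only [hT, Finset.mem_filter, Finset.mem_univ, true_and]
        exact ⟨e₀, he₀, Or.inl rfl⟩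
      have hpow : (T.erase (G.a e₀)).powerset.card < (C.erase e₀).powerset.card := by
        rw [Finset.card_powerset, Finset.card_powerset, Finset.card_erase_of_mem he₀,
          Finset.card_erase_of_mem hv₀]
        have := Finset.card_pos.mpr ⟨_, hv₀⟩
        exact Nat.pow_lt_pow_right (by norm_num) (by omega)
      obtain ⟨D₁, h₁, D₂, h₂, hne, heq⟩ := Finset.exists_ne_map_eq_of_card_lt_of_maps_to hpow
        (f := fun D => (T.erase (G.a e₀)).filter fun v => Odd (G.deg D v))
        (fun D _ => by
          simp only [Finset.coe_powerset, Set.mem_preimage, Set.mem_powerset_iff, Finset.coe_subset]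
          exact Finset.filter_subset _ _)
      rw [Finset.mem_powerset] at h₁ h₂
      have hsub : symmDiff D₁ D₂ ⊆ C.erase e₀ := by
        intro e he
        rw [Finset.mem_symmDiff] at he
        rcases he with he | he
        · exact h₁ he.1
        · exact h₂ he.1
      have hsub' := hsub.trans (Finset.erase_subset _ _)
      have hev : ∀ v ∈ T.erase (G.a e₀), Even (G.deg (symmDiff D₁ D₂) v) := by
        intro v hv
        refine G.even_deg_symmDiff ?_
        have := Finset.ext_iff.mp heq v
        simpa [Finset.mem_filter, hv, (Finset.mem_erase.mp hv).1,
          (Finset.mem_erase.mp hv).2] using this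
      have key := hmin _ hsub' (by
        rw [Finset.nonempty_iff_ne_empty]
        intro h
        exact hne (symmDiff_eq_bot.mp h)) (by
        intro v
        by_cases hv : v ∈ T
        · by_cases hv' : v = G.a e₀
          · have h := hsumT _ hsub'
            rw [← Finset.add_sum_erase _ _ hv₀] at h
            have : Even (∑ v ∈ T.erase (G.a e₀), G.deg (symmDiff D₁ D₂) v) := Finset.even_sum _ hev
            subst hv'
            grind
          · exact hev v (Finset.mem_erase.mpr ⟨hv', hv⟩)
        · rw [G.deg_eq_zero]
          · exact Even.zero
          · rintro ⟨e, he, h⟩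
            exact hv (by simp only [hT, Finset.mem_filter, Finset.mem_univ, true_and]
                         exact ⟨e, hsub' he, h⟩))
      exact Finset.notMem_erase e₀ C (hsub (key ▸ he₀))
    have hge : ∀ v ∈ T, 2 ≤ G.deg C v := by
      intro v hv
      have hpos := G.deg_pos (Finset.mem_filter.mp hv).2
      have := heven v
      grind
    intro v hv
    have hvT : v ∈ T := Finset.mem_filter.mpr ⟨Finset.mem_univ _, hv⟩
    have hsum : ∑ v ∈ T, 2 = ∑ v ∈ T, G.deg C v := by
      refine le_antisymm (Finset.sum_le_sum hge) ?_
      rw [hsumT C subset_rfl, Finset.sum_const, smul_eq_mul]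
      omega
    exact ((Finset.sum_eq_sum_iff_of_le hge).mp hsum v hvT).symm
  · intro v w hv hw
    set D := C.filter fun e => Relation.ReflTransGen (G.AdjIn C) v (G.a e) with hD
    have hab : ∀ e ∈ C, (Relation.ReflTransGen (G.AdjIn C) v (G.a e) ↔
        Relation.ReflTransGen (G.AdjIn C) v (G.b e)) := fun e he =>
      ⟨fun h => h.tail ⟨e, he, Or.inl ⟨rfl, rfl⟩⟩, fun h => h.tail ⟨e, he, Or.inr ⟨rfl, rfl⟩⟩⟩
    have key : D = C := by
      refine hmin D (Finset.filter_subset _ _) ?_ fun u => ?_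
      · obtain ⟨e, he, h⟩ := hv
        refine ⟨e, Finset.mem_filter.mpr ⟨he, ?_⟩⟩
        rcases h with h | h
        · rw [h]
        · rw [hab e he, h]
      · by_cases hu : Relation.ReflTransGen (G.AdjIn C) v u
        · have : G.deg D u = G.deg C u := by
            refine Finset.sum_subset (Finset.filter_subset _ _) fun e he heD => ?_
            have hn : ¬ Relation.ReflTransGen (G.AdjIn C) v (G.a e) := fun h =>
              heD (Finset.mem_filter.mpr ⟨he, h⟩)
            have ha : G.a e ≠ u := fun h => hn (h ▸ hu)
            have hb : G.b e ≠ u := fun h => hn ((hab e he).mpr (h ▸ hu))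
            simp [ha, hb]
          rw [this]
          exact heven u
        · rw [G.deg_eq_zero]
          · exact Even.zero
          · rintro ⟨e, he, h⟩
            obtain ⟨heC, he⟩ := Finset.mem_filter.mp he
            rcases h with h | h
            · exact hu (h ▸ he)
            · exact hu (h ▸ (hab e heC).mp he)
    obtain ⟨e, he, h⟩ := hw
    have hr := (Finset.mem_filter.mp (key ▸ he : e ∈ D)).2
    rcases h with h | h
    · exact h ▸ hr
    · exact h ▸ (hab e he).mp hr

lemma exists_isCircuit_subset [Fintype V] [DecidableEq E] (G : SignedGraph V E) {S : Finset E}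
    (hne : S.Nonempty) (heven : ∀ v, Even (G.deg S v)) : ∃ C ⊆ S, G.IsCircuit C := by
  obtain ⟨C, hCS, hC⟩ := exists_minimal_le_of_wellFoundedLT
    (fun D : Finset E => D.Nonempty ∧ ∀ v, Even (G.deg D v)) S ⟨hne, heven⟩
  exact ⟨C, hCS, G.isCircuit_of_minimal hC.prop.1 hC.prop.2 fun D hD h₁ h₂ =>
    le_antisymm hD (hC.le_of_le ⟨h₁, h₂⟩ hD)⟩

end Degree

section Component

variable {V E : Type}

lemma component_eq_of_adj (G : SignedGraph V E) {v w : V} (h : G.Adj v w) :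
    G.component v = G.component w :=
  Quotient.sound (Relation.EqvGen.rel _ _ h)

lemma component_a_eq_b (G : SignedGraph V E) (e : E) :
    G.component (G.a e) = G.component (G.b e) :=
  G.component_eq_of_adj ⟨e, Or.inl ⟨rfl, rfl⟩⟩

lemma component_eq_of_reflTransGen_adjIn (G : SignedGraph V E) {S : Finset E} {v w : V}
    (h : Relation.ReflTransGen (G.AdjIn S) v w) : G.component v = G.component w := by
  induction h with
  | refl => rfl
  | tail _ h ih =>
    obtain ⟨e, -, h⟩ := h
    exact ih.trans (G.component_eq_of_adj ⟨e, h⟩)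

lemma IsCircuit.component_eq [DecidableEq V] {G : SignedGraph V E} {C : Finset E}
    (h : G.IsCircuit C) {e e' : E} (he : e ∈ C) (he' : e' ∈ C) :
    G.component (G.a e) = G.component (G.a e') :=
  G.component_eq_of_reflTransGen_adjIn
    (h.2.2 _ _ ⟨e, he, Or.inl rfl⟩ ⟨e', he', Or.inl rfl⟩)

end Component

section CycleSpace

variable {V E : Type} [DecidableEq V]

/-- The unsigned incidence matrix modulo two; the column of a loop vanishes. -/
def incMatrix (G : SignedGraph V E) : Matrix V E (ZMod 2) :=
  Matrix.of fun v e => (if G.a e = v then 1 else 0) + (if G.b e = v then 1 else 0)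

/-- The edge space vectors with even degree at each vertex. -/
def cycleSpace [Fintype E] (G : SignedGraph V E) : Submodule (ZMod 2) (E → ZMod 2) :=
  LinearMap.ker G.incMatrix.mulVecLin

open Classical in
/-- The indicator vector of an edge set. -/
noncomputable def edgeVec (S : Finset E) : E → ZMod 2 := fun e => if e ∈ S then 1 else 0

lemma incMatrix_mulVec_edgeVec [Fintype E] (G : SignedGraph V E) (S : Finset E) (v : V) :
    G.incMatrix.mulVec (edgeVec S) v = (G.deg S v : ZMod 2) := by
  classical
  simp [Matrix.mulVec, dotProduct, incMatrix, edgeVec, deg]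

lemma edgeVec_mem_cycleSpace [Fintype E] (G : SignedGraph V E) (S : Finset E) :
    edgeVec S ∈ G.cycleSpace ↔ ∀ v, Even (G.deg S v) := by
  rw [cycleSpace, LinearMap.mem_ker, funext_iff]
  refine forall_congr' fun v => ?_
  rw [Matrix.mulVecLin_apply, incMatrix_mulVec_edgeVec, Pi.zero_apply,
    ZMod.natCast_eq_zero_iff_even]

lemma exists_edgeVec_eq [Fintype E] (f : E → ZMod 2) : ∃ S : Finset E, edgeVec S = f := by
  classical
  refine ⟨Finset.univ.filter fun e => f e ≠ 0, funext fun e => ?_⟩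
  simp only [edgeVec, Finset.mem_filter, Finset.mem_univ, true_and]
  generalize f e = x
  revert x
  decide


lemma finrank_cycleSpace [Fintype V] [Fintype E] (G : SignedGraph V E) :
    Module.finrank (ZMod 2) G.cycleSpace + Fintype.card V =
      Fintype.card E + Nat.card (Quotient G.compSetoid) := by
  classical
  have h₁ := LinearMap.finrank_range_add_finrank_ker G.incMatrix.mulVecLin
  have h₂ := LinearMap.finrank_range_add_finrank_ker G.incMatrix.transpose.mulVecLin
  have h₃ : Module.finrank (ZMod 2) (LinearMap.range G.incMatrix.transpose.mulVecLin) =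
      Module.finrank (ZMod 2) (LinearMap.range G.incMatrix.mulVecLin) :=
    G.incMatrix.rank_transpose
  have hker : LinearMap.ker G.incMatrix.transpose.mulVecLin =
      LinearMap.range (LinearMap.funLeft (ZMod 2) (ZMod 2) G.component) := by
    have hE : ∀ g : V → ZMod 2, g ∈ LinearMap.ker G.incMatrix.transpose.mulVecLin ↔
        ∀ e, g (G.a e) = g (G.b e) := by
      intro g
      rw [LinearMap.mem_ker, funext_iff]
      refine forall_congr' fun e => ?_
      have : G.incMatrix.transpose.mulVecLin g e = g (G.a e) + g (G.b e) := by
        simp [Matrix.vecMul, dotProduct, incMatrix, mul_add, Finset.sum_add_distrib]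
      rw [this, Pi.zero_apply, CharTwo.add_eq_zero]
    ext g
    rw [hE, LinearMap.mem_range]
    constructor
    · intro h
      have hg : ∀ v w, Relation.EqvGen G.Adj v w → g v = g w := by
        intro v w hvw
        induction hvw with
        | rel v w h' =>
          obtain ⟨e, ⟨rfl, rfl⟩ | ⟨rfl, rfl⟩⟩ := h'
          · exact h e
          · exact (h e).symm
        | refl => rfl
        | symm _ _ _ ih => exact ih.symm
        | trans _ _ _ _ _ ih₁ ih₂ => exact ih₁.trans ih₂
      exact ⟨Quotient.lift g hg, rfl⟩
    · rintro ⟨f, rfl⟩ e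
      simp [LinearMap.funLeft_apply, G.component_a_eq_b e]
  have : Fintype (Quotient G.compSetoid) := Fintype.ofFinite _
  have hcomp : Function.Surjective G.component := Quotient.mk_surjective
  rw [hker, LinearMap.finrank_range_of_inj
    (LinearMap.funLeft_injective_of_surjective _ _ _ hcomp)] at h₂
  simp only [Module.finrank_fintype_fun_eq_card] at h₁ h₂
  rw [Nat.card_eq_fintype_card]
  unfold cycleSpace
  omega

/-- The combination of chosen circuits, one per component, with given coefficients. -/
noncomputable def circuitCombination (G : SignedGraph V E)
    (C : Quotient G.compSetoid → Finset E) :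
    (Quotient G.compSetoid → ZMod 2) →ₗ[ZMod 2] (E → ZMod 2) where
  toFun g e := edgeVec (C (G.component (G.a e))) e * g (G.component (G.a e))
  map_add' g g' := by ext e; simp [mul_add]
  map_smul' c g := by ext e; simp [mul_left_comm]

end CycleSpace

section ChosenCircuits

variable {V E : Type} {G : SignedGraph V E} {C : Quotient G.compSetoid → Finset E}

lemma circuitCombination_mem_cycleSpace [DecidableEq V] [Fintype E]
    (hC : ∀ q, G.IsCircuit (C q))
    (g : Quotient G.compSetoid → ZMod 2) : G.circuitCombination C g ∈ G.cycleSpace := by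
  rw [cycleSpace, LinearMap.mem_ker]
  funext v
  have h : G.incMatrix.mulVec (G.circuitCombination C g) v =
      G.incMatrix.mulVec (edgeVec (C (G.component v))) v * g (G.component v) := by
    simp only [Matrix.mulVec, dotProduct, Finset.sum_mul]
    refine Finset.sum_congr rfl fun e _ => ?_
    by_cases hv : G.component (G.a e) = G.component v
    · simp [circuitCombination, hv, mul_assoc]
    · have ha : G.a e ≠ v := fun h => hv (by rw [h])
      have hb : G.b e ≠ v := fun h => hv (by rw [component_a_eq_b, h])
      simp [incMatrix, ha, hb]
  rw [Matrix.mulVecLin_apply, h, incMatrix_mulVec_edgeVec,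
    ZMod.natCast_eq_zero_iff_even.mpr ((hC _).even_deg v), zero_mul, Pi.zero_apply]

lemma circuitCombination_apply_of_mem {g : Quotient G.compSetoid → ZMod 2} {e : E}
    {q : Quotient G.compSetoid} (hq : G.component (G.a e) = q) (he : e ∈ C q) :
    G.circuitCombination C g e = g q := by
  subst hq
  simp [circuitCombination, edgeVec, he]

lemma circuitCombination_injective (hC : ∀ q, ∃ e ∈ C q, G.component (G.a e) = q) :
    Function.Injective (G.circuitCombination C) := by
  intro g g' h
  funext q
  obtain ⟨e, he, hq⟩ := hC q
  rw [← circuitCombination_apply_of_mem (g := g) hq he, h, circuitCombination_apply_of_mem hq he]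

open Classical in
lemma circuitCombination_single [DecidableEq V] (hC : ∀ q, G.IsCircuit (C q))
    (hC' : ∀ q, ∃ e ∈ C q, G.component (G.a e) = q) (q : Quotient G.compSetoid) :
    G.circuitCombination C (Pi.single q 1) = edgeVec (C q) := by
  funext e
  obtain ⟨e₀, he₀, hq₀⟩ := hC' q
  by_cases hq : G.component (G.a e) = q
  · simp [circuitCombination, hq]
  · have he : e ∉ C q := fun he => hq (((hC q).component_eq he he₀).trans hq₀)
    simp [circuitCombination, edgeVec, he, hq]

lemma edgeVec_mem_range_circuitCombination [Fintype V] [DecidableEq V]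
    (hC : ∀ q, G.IsCircuit (C q))
    (hC' : ∀ q, ∃ e ∈ C q, G.component (G.a e) = q)
    (huniq : ∀ q, ∀ D, G.IsCircuit D → (∃ e ∈ D, G.component (G.a e) = q) → D = C q)
    (S : Finset E) (hS : ∀ v, Even (G.deg S v)) :
    edgeVec S ∈ LinearMap.range (G.circuitCombination C) := by
  classical
  induction S using Finset.strongInduction with
  | H S ih =>
    rcases S.eq_empty_or_nonempty with rfl | hne
    · have : edgeVec (∅ : Finset E) = 0 := by funext e; simp [edgeVec]
      rw [this]
      exact zero_mem _
    · obtain ⟨D, hDS, hD⟩ := G.exists_isCircuit_subset hne hS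
      have hdec : edgeVec S = edgeVec (S \ D) + edgeVec D := by
        funext e
        by_cases he : e ∈ D
        · simp [edgeVec, he, hDS he]
        · simp [edgeVec, he]
      rw [hdec]
      refine add_mem (ih _ (Finset.sdiff_ssubset hDS hD.1) fun v => ?_) ?_
      · have := G.deg_sdiff_add_deg hDS v
        have := hS v
        have := hD.even_deg v
        grind
      · obtain ⟨e, he⟩ := hD.1
        rw [huniq _ D hD ⟨e, he, rfl⟩]
        exact ⟨_, circuitCombination_single hC hC' _⟩

/-- If each component has a chosen circuit, then there are at least as many edges as vertices,
with equality exactly when the chosen circuits are the only ones. -/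
lemma card_le_and_card_eq_iff [Fintype V] [DecidableEq V] [Fintype E]
    (hC : ∀ q, G.IsCircuit (C q))
    (hC' : ∀ q, ∃ e ∈ C q, G.component (G.a e) = q) :
    Fintype.card V ≤ Fintype.card E ∧
      (Fintype.card E = Fintype.card V ↔
        ∀ q, ∀ D, G.IsCircuit D → (∃ e ∈ D, G.component (G.a e) = q) → D = C q) := by
  classical
  have : Fintype (Quotient G.compSetoid) := Fintype.ofFinite _
  have hle : LinearMap.range (G.circuitCombination C) ≤ G.cycleSpace := by
    rintro _ ⟨g, rfl⟩
    exact circuitCombination_mem_cycleSpace hC g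
  have hrange := LinearMap.finrank_range_of_inj (circuitCombination_injective hC')
  rw [Module.finrank_fintype_fun_eq_card, ← Nat.card_eq_fintype_card] at hrange
  have hdim := G.finrank_cycleSpace
  have hmono := Submodule.finrank_mono hle
  refine ⟨by omega, fun hcard q D hD hDq => ?_, fun huniq => ?_⟩
  · have heq : LinearMap.range (G.circuitCombination C) = G.cycleSpace :=
      Submodule.eq_of_le_of_finrank_eq hle (by omega)
    obtain ⟨g, hg⟩ := heq.ge ((G.edgeVec_mem_cycleSpace D).mpr hD.even_deg)
    obtain ⟨e₀, he₀, hq₀⟩ := hDq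
    have hcomp : ∀ e ∈ D, G.component (G.a e) = q := fun e he =>
      (hD.component_eq he he₀).trans hq₀
    have hsub : D ⊆ C q := by
      intro e he
      have h := congrFun hg e
      by_contra hn
      simp [circuitCombination, hcomp e he, edgeVec, hn, he] at h
    have hgq : g q = 1 := by
      rw [← circuitCombination_apply_of_mem (g := g) hq₀ (hsub he₀), hg]
      simp [edgeVec, he₀]
    refine hsub.antisymm fun e he => ?_
    have h := congrFun hg e
    rw [circuitCombination_apply_of_mem
      (((hC q).component_eq he (hsub he₀)).trans hq₀) he, hgq] at h
    by_contra hn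
    simp [edgeVec, hn] at h
  · have hge : G.cycleSpace ≤ LinearMap.range (G.circuitCombination C) := by
      intro f hf
      obtain ⟨S, rfl⟩ := exists_edgeVec_eq f
      exact edgeVec_mem_range_circuitCombination hC hC' huniq S
        ((G.edgeVec_mem_cycleSpace S).mp hf)
    have := Submodule.finrank_mono hge
    omega

end ChosenCircuits

section Delete

variable {V E : Type}

lemma adjIn_delete_iff [DecidableEq E] (G : SignedGraph V E) {F : Finset E}
    (C : Finset {e : E // e ∉ F})
    (v w : V) : (G.delete F).AdjIn C v w ↔
      G.AdjIn (C.map (Function.Embedding.subtype _)) v w := by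
  simp [AdjIn, delete]

lemma touches_delete_iff [DecidableEq E] (G : SignedGraph V E) {F : Finset E}
    (C : Finset {e : E // e ∉ F})
    (v : V) : (∃ e ∈ C, (G.delete F).a e = v ∨ (G.delete F).b e = v) ↔
      ∃ e ∈ C.map (Function.Embedding.subtype _), G.a e = v ∨ G.b e = v := by
  simp [delete]

lemma isUnbalancedCircuit_delete_iff [DecidableEq V] [DecidableEq E]
    (G : SignedGraph V E) {F : Finset E} (C : Finset {e : E // e ∉ F}) :
    (G.delete F).IsUnbalancedCircuit C ↔
      G.IsUnbalancedCircuit (C.map (Function.Embedding.subtype _)) := by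
  have hadj : (G.delete F).AdjIn C = G.AdjIn (C.map (Function.Embedding.subtype _)) := by
    funext v w
    exact propext (G.adjIn_delete_iff C v w)
  have hdeg : ∀ v, (G.delete F).deg C v =
      G.deg (C.map (Function.Embedding.subtype _)) v := by
    intro v
    simp only [deg, delete, Finset.sum_map]
    rfl
  have hcard : (C.filter fun e => (G.delete F).sign e = -1).card =
      ((C.map (Function.Embedding.subtype _)).filter fun e => G.sign e = -1).card := by
    rw [Finset.filter_map, Finset.card_map]
    rfl
  simp only [IsUnbalancedCircuit, IsCircuit, hadj, hdeg, hcard, touches_delete_iff,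
    Finset.map_nonempty]

lemma exists_isUnbalancedCircuit_delete [DecidableEq V] [DecidableEq E]
    (G : SignedGraph V E) {F C : Finset E}
    (hC : G.IsUnbalancedCircuit C) (hF : ∀ e ∈ C, e ∉ F) :
    ∃ C' : Finset {e : E // e ∉ F}, C'.map (Function.Embedding.subtype _) = C ∧
      (G.delete F).IsUnbalancedCircuit C' := by
  have h : (C.subtype fun e => e ∉ F).map (Function.Embedding.subtype _) = C :=
    Finset.subtype_map_of_mem hF
  exact ⟨_, h, (G.isUnbalancedCircuit_delete_iff _).mpr (h.symm ▸ hC)⟩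

end Delete

section Cut

variable {V E : Type} [DecidableEq V] [Fintype E]

lemma IsCut.exists_isBond_subset [DecidableEq E] {G : SignedGraph V E} {B : Finset E}
    (h : G.IsCut B) : ∃ B' ⊆ B, G.IsBond B' := by
  obtain ⟨B', hB', hmin⟩ := exists_minimal_le_of_wellFoundedLT G.IsCut B h
  exact ⟨B', hB', hmin.prop, fun D hD hcut => le_antisymm hD (hmin.le_of_le hcut hD)⟩

lemma NoBrokenBond.not_isCut [LinearOrder E] {G : SignedGraph V E} {F B : Finset E}
    (hF : G.NoBrokenBond F) (hB : B ⊆ F) : ¬ G.IsCut B := by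
  intro hcut
  obtain ⟨B', hB', hbond⟩ := hcut.exists_isBond_subset
  exact hF _ ⟨B', hbond, hbond.1.1, rfl⟩
    ((Finset.erase_subset _ _).trans (hB'.trans hB))

/-- A closed nonempty vertex set that is balanced after deleting `F` yields a cut in `F`. -/
lemma exists_isCut_subset [Fintype V] [DecidableEq E] {G : SignedGraph V E}
    (hconn : G.Connected) (hunb : G.Unbalanced) {F : Finset E} {X : Finset V}
    (hX : X.Nonempty) (hcross : G.crossEdges X ⊆ F)
    (hbal : G.BalancedOn (G.insideEdges X \ F)) : ∃ B ⊆ F, G.IsCut B := by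
  have hbal' : G.BalancedOn (G.insideEdges X \ (G.insideEdges X ∩ F)) := by
    rwa [Finset.sdiff_inter_self_left]
  obtain ⟨EX, hEX, hmin⟩ := exists_minimal_le_of_wellFoundedLT
    (fun S => G.BalancedOn (G.insideEdges X \ S)) _ hbal'
  refine ⟨G.crossEdges X ∪ EX,
    Finset.union_subset hcross (hEX.trans Finset.inter_subset_right), ?_, X, hX, EX,
    hEX.trans Finset.inter_subset_left, hmin.prop,
    fun EX' hsub h => le_antisymm hsub (hmin.le_of_le h hsub), rfl⟩
  rw [Finset.nonempty_iff_ne_empty]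
  intro hempty
  rw [Finset.union_eq_empty] at hempty
  obtain ⟨hc, rfl⟩ := hempty
  obtain ⟨x, hx⟩ := hX
  have hstep : ∀ e, G.a e ∈ X ↔ G.b e ∈ X := by
    intro e
    have : e ∉ G.crossEdges X := by simp [hc]
    simp only [crossEdges, Finset.mem_filter, Finset.mem_univ, true_and] at this
    tauto
  have hall : ∀ v, v ∈ X := by
    intro v
    have hv := hconn x v
    induction hv with
    | refl => exact hx
    | tail _ h ih =>
      obtain ⟨e, ⟨rfl, rfl⟩ | ⟨rfl, rfl⟩⟩ := h
      · exact (hstep e).mp ih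
      · exact (hstep e).mpr ih
  obtain ⟨C, hC⟩ := hunb
  refine hmin.prop C (fun e _ => ?_) hC
  simp [insideEdges, hall]

/-- If `F` contains no broken bond, every component of `G - F` is unbalanced. -/
lemma NoBrokenBond.compUnbalanced_delete [Fintype V] [LinearOrder E] {G : SignedGraph V E}
    (hconn : G.Connected) (hunb : G.Unbalanced) {F : Finset E} (hF : G.NoBrokenBond F)
    (q : Quotient (G.delete F).compSetoid) : (G.delete F).CompUnbalanced q := by
  classical
  by_contra hq
  set X : Finset V := Finset.univ.filter fun v => (G.delete F).component v = q with hXdef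
  have hX : X.Nonempty := by
    obtain ⟨v, hv⟩ := Quotient.mk_surjective q
    exact ⟨v, Finset.mem_filter.mpr ⟨Finset.mem_univ _, hv⟩⟩
  have hcross : G.crossEdges X ⊆ F := by
    intro e he
    by_contra heF
    have h := (G.delete F).component_a_eq_b ⟨e, heF⟩
    simp only [delete] at h
    simp only [crossEdges, hXdef, Finset.mem_filter, Finset.mem_univ, true_and] at he
    simp only [delete] at he
    rw [h] at he
    tauto
  have hbal : G.BalancedOn (G.insideEdges X \ F) := by
    intro C hCsub hC
    obtain ⟨C', rfl, hC'⟩ := G.exists_isUnbalancedCircuit_delete hC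
      fun e he => (Finset.mem_sdiff.mp (hCsub he)).2
    obtain ⟨e, he⟩ := hC'.1.1
    have hin := (Finset.mem_sdiff.mp (hCsub (Finset.mem_map_of_mem _ he))).1
    exact hq ⟨C', hC', e, he, (Finset.mem_filter.mp (Finset.mem_filter.mp hin).2.1).2⟩
  obtain ⟨B, hB, hcut⟩ := exists_isCut_subset hconn hunb hX hcross hbal
  exact hF.not_isCut hB hcut

end Cut

end SignedGraph

/-- For a connected unbalanced signed graph `G` and a broken-bond-free
edge set `F`, one has `|F| = m - n` iff every connected component of `G - F` contains
exactly one circuit and that circuit is unbalanced. -/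
theorem maximal_broken_bond_free_iff {V E : Type}
    [Fintype V] [DecidableEq V] [Fintype E] [LinearOrder E]
    (G : SignedGraph V E) (hconn : G.Connected) (hunb : G.Unbalanced)
    (F : Finset E) (hF : G.NoBrokenBond F) :
    F.card = Fintype.card E - Fintype.card V ↔
      ∀ q : Quotient (G.delete F).compSetoid,
        ∃ C : Finset {e : E // e ∉ F},
          ((G.delete F).IsCircuit C ∧
            (∃ e ∈ C, (G.delete F).component ((G.delete F).a e) = q)) ∧
          (G.delete F).IsUnbalancedCircuit C ∧
          ∀ C' : Finset {e : E // e ∉ F},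
            (G.delete F).IsCircuit C' →
            (∃ e ∈ C', (G.delete F).component ((G.delete F).a e) = q) → C' = C := by
  choose C hC hCq using fun q => hF.compUnbalanced_delete hconn hunb q
  obtain ⟨hle, hiff⟩ := SignedGraph.card_le_and_card_eq_iff (fun q => (hC q).1) hCq
  have hcard : Fintype.card {e : E // e ∉ F} = Fintype.card E - F.card := by
    rw [Fintype.card_subtype_compl, Fintype.card_coe]
  have hFle : F.card ≤ Fintype.card E := Finset.card_le_univ F
  have hcount : F.card = Fintype.card E - Fintype.card V ↔
      Fintype.card {e : E // e ∉ F} = Fintype.card V := by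
    omega
  rw [hcount, hiff]
  constructor
  · intro huniq q
    exact ⟨C q, ⟨(hC q).1, hCq q⟩, hC q, huniq q⟩
  · intro h q D hD hDq
    obtain ⟨C', -, -, huniq⟩ := h q
    rw [huniq D hD hDq, huniq (C q) (hC q).1 (hCq q)]
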